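/- arXiv:1305.2476 — 2 statements merged into one kernel-verified Lean document; each statement's English description precedes it below -/
import Mathlib

section
/- Let F be an absolutely continuous distribution function on the real line with density f satisfying ∫|x|dF(x) < ∞. Then ∫ F(x){1 − F(x)} dx = (2π)^{-1} ∫ t^{-2} {1 − |φ_f(t)|²} dt, where φ_f(t) = ∫ e^{itx} f(x)dx is the characteristic function of F. -/
open MeasureTheory Real Set

/-- The Fourier transform `φ_g(t) = ∫ e^{itx} g(x) dx` of a real function. -/
noncomputable def fourierTr (g : ℝ → ℝ) (t : ℝ) : ℂ :=
  ∫ x : ℝ, Complex.exp (Complex.I * t * x) * (g x : ℂ)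

/-- The kernel `(1 - cos t) / t²` is integrable on the real line. -/
lemma integrable_inv_sq_mul_one_sub_cos :
    Integrable (fun t : ℝ => (t ^ 2)⁻¹ * (1 - cos t)) := by
  refine (integrable_inv_one_add_sq.const_mul (5 / 2)).mono'
    (by fun_prop) (Filter.Eventually.of_forall fun t => ?_)
  have hcos : 0 ≤ 1 - cos t := by linarith [cos_le_one t]
  rw [norm_of_nonneg (by positivity)]
  rcases eq_or_ne t 0 with rfl | ht
  · norm_num
  have ht2 : 0 < t ^ 2 := by positivity
  rw [inv_mul_eq_div, ← div_eq_mul_inv, div_le_div_iff₀ ht2 (by positivity)]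
  nlinarith [one_sub_sq_div_two_le_cos (x := t), neg_one_le_cos t]

lemma inv_sq_mul_one_sub_cos_mul (u t : ℝ) :
    (t ^ 2)⁻¹ * (1 - cos (t * u)) = u ^ 2 * (((t * u) ^ 2)⁻¹ * (1 - cos (t * u))) := by
  rcases eq_or_ne u 0 with rfl | hu
  · simp
  · rw [mul_pow, mul_inv]
    field_simp

lemma integrable_inv_sq_mul_one_sub_cos_mul (u : ℝ) :
    Integrable (fun t : ℝ => (t ^ 2)⁻¹ * (1 - cos (t * u))) := by
  rcases eq_or_ne u 0 with rfl | hu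
  · simp
  · simp_rw [inv_sq_mul_one_sub_cos_mul u]
    exact (integrable_inv_sq_mul_one_sub_cos.comp_mul_right' hu).const_mul _

lemma integral_inv_sq_mul_one_sub_cos_mul_eq_abs_mul (u : ℝ) :
    ∫ t : ℝ, (t ^ 2)⁻¹ * (1 - cos (t * u)) =
      |u| * ∫ t : ℝ, (t ^ 2)⁻¹ * (1 - cos t) := by
  simp_rw [inv_sq_mul_one_sub_cos_mul u]
  rw [integral_const_mul,
    Measure.integral_comp_mul_right (fun t : ℝ => (t ^ 2)⁻¹ * (1 - cos t)) u, smul_eq_mul,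
    ← mul_assoc]
  congr 1
  rcases eq_or_ne u 0 with rfl | hu
  · simp
  · rw [abs_inv, ← sq_abs, sq, mul_assoc, mul_inv_cancel₀ (abs_ne_zero.2 hu), mul_one]

/-- Integrating the identity `∫ t⁻² (1 - cos (t u)) dt = |u| ∫ t⁻² (1 - cos t) dt` against a
weight and exchanging the order of integration. -/
lemma integral_mul_abs_mul_integral_inv_sq_mul_one_sub_cos {Ω : Type*} [MeasurableSpace Ω]
    {P : Measure Ω} [SFinite P] {w U : Ω → ℝ} (hw : Measurable w) (hU : Measurable U)
    (hwU : Integrable (fun ω => w ω * |U ω|) P) :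
    (∫ ω, w ω * |U ω| ∂P) * ∫ t : ℝ, (t ^ 2)⁻¹ * (1 - cos t) =
      ∫ t : ℝ, (t ^ 2)⁻¹ * ∫ ω, w ω * (1 - cos (t * U ω)) ∂P := by
  have hprod : Integrable
      (Function.uncurry fun (ω : Ω) (t : ℝ) => w ω * ((t ^ 2)⁻¹ * (1 - cos (t * U ω))))
      (P.prod volume) := by
    rw [integrable_prod_iff (Measurable.aestronglyMeasurable (by fun_prop))]
    refine ⟨Filter.Eventually.of_forall fun ω => ?_, ?_⟩
    · exact (integrable_inv_sq_mul_one_sub_cos_mul (U ω)).const_mul (w ω)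
    have hnorm : ∀ ω, ∫ t : ℝ, ‖w ω * ((t ^ 2)⁻¹ * (1 - cos (t * U ω)))‖ =
        ‖w ω * |U ω|‖ * ∫ t : ℝ, (t ^ 2)⁻¹ * (1 - cos t) := fun ω => by
      have hk : ∀ t : ℝ, ‖w ω * ((t ^ 2)⁻¹ * (1 - cos (t * U ω)))‖ =
          ‖w ω‖ * ((t ^ 2)⁻¹ * (1 - cos (t * U ω))) := fun t => by
        have : 0 ≤ 1 - cos (t * U ω) := by linarith [cos_le_one (t * U ω)]
        rw [norm_mul, norm_of_nonneg (r := _ * _) (by positivity)]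
      simp_rw [hk]
      rw [integral_const_mul, integral_inv_sq_mul_one_sub_cos_mul_eq_abs_mul, norm_mul,
        norm_eq_abs |U ω|, abs_abs, mul_assoc]
    simp only [Function.uncurry_apply_pair, hnorm]
    exact hwU.norm.mul_const _
  calc _ = ∫ ω, (∫ t : ℝ, w ω * ((t ^ 2)⁻¹ * (1 - cos (t * U ω)))) ∂P := by
        simp_rw [integral_const_mul, integral_inv_sq_mul_one_sub_cos_mul_eq_abs_mul, ← mul_assoc]
        rw [integral_mul_const]
    _ = ∫ t : ℝ, ∫ ω, w ω * ((t ^ 2)⁻¹ * (1 - cos (t * U ω))) ∂P := integral_integral_swap hprod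
    _ = _ := by simp_rw [mul_left_comm (w _), integral_const_mul]

lemma integral_exp_neg_mul_one_sub_cos (t : ℝ) :
    ∫ u in Ioi (0 : ℝ), exp (-u) * (1 - cos (t * u)) = t ^ 2 * (1 + t ^ 2)⁻¹ := by
  have hre : (-1 + t * Complex.I).re < 0 := by simp
  have hcexp : ∀ u : ℝ, (Complex.exp ((-1 + t * Complex.I) * u)).re = exp (-u) * cos (t * u) :=
    fun u => by simp [Complex.exp_re]
  have hintegrable := integrableOn_exp_mul_complex_Ioi hre 0
  have hcos : ∫ u in Ioi (0 : ℝ), exp (-u) * cos (t * u) = (1 + t ^ 2)⁻¹ := by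
    have := integral_re hintegrable
    simp only [RCLike.re_to_complex, hcexp, integral_exp_mul_complex_Ioi hre] at this
    rw [this]
    simp [Complex.div_re, Complex.normSq_apply, sq]
  have hcosint : Integrable (fun u : ℝ => exp (-u) * cos (t * u)) (volume.restrict (Ioi 0)) := by
    simpa only [RCLike.re_to_complex, hcexp] using hintegrable.re
  have hexpint : IntegrableOn (fun u : ℝ => exp (-u)) (Ioi 0) := by
    simpa using integrableOn_exp_mul_Ioi (neg_one_lt_zero (R := ℝ)) 0
  simp_rw [mul_sub, mul_one]
  rw [integral_sub hexpint hcosint, hcos, integral_exp_neg_Ioi_zero]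
  field_simp
  ring

/-- The integral of the kernel `(1 - cos t) / t²` over the real line. -/
lemma integral_inv_sq_mul_one_sub_cos : ∫ t : ℝ, (t ^ 2)⁻¹ * (1 - cos t) = π := by
  have habs : EqOn (fun u : ℝ => exp (-u) * u ^ ((2 : ℝ) - 1)) (fun u => exp (-u) * |u|)
      (Ioi 0) := fun u (hu : 0 < u) => by
    norm_num [abs_of_pos hu]
  have hintegrable : IntegrableOn (fun u : ℝ => exp (-u) * |u|) (Ioi 0) :=
    (GammaIntegral_convergent two_pos).congr_fun habs measurableSet_Ioi
  have hone : ∫ u in Ioi (0 : ℝ), exp (-u) * |u| = 1 := by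
    rw [← setIntegral_congr_fun measurableSet_Ioi habs, ← Gamma_eq_integral two_pos, Gamma_two]
  have := integral_mul_abs_mul_integral_inv_sq_mul_one_sub_cos (by fun_prop) measurable_id hintegrable
  simp only [id, hone, one_mul, integral_exp_neg_mul_one_sub_cos] at this
  rw [this, ← integral_univ_inv_one_add_sq]
  refine integral_congr_ae ?_
  filter_upwards [Measure.ae_ne volume 0] with t ht
  rw [inv_mul_cancel_left₀ (pow_ne_zero 2 ht)]

/-- The squared modulus of a characteristic function is the expected cosine of the
symmetrization. -/
lemma norm_charFun_sq_eq_integral_cos (μ : Measure ℝ) [IsProbabilityMeasure μ] (t : ℝ) :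
    ‖charFun μ t‖ ^ 2 = ∫ p : ℝ × ℝ, cos (t * (p.2 - p.1)) ∂μ.prod μ := by
  have hc : charFun μ t * charFun μ (-t) =
      ∫ p : ℝ × ℝ, Complex.exp ((t * (p.1 - p.2) : ℝ) * Complex.I) ∂μ.prod μ := by
    simp_rw [charFun_apply_real]
    rw [← integral_prod_mul]
    refine integral_congr_ae (Filter.Eventually.of_forall fun p => ?_)
    simp only [← Complex.exp_add]
    congr 1
    push_cast
    ring
  have hintegrable : Integrable
      (fun p : ℝ × ℝ => Complex.exp ((t * (p.1 - p.2) : ℝ) * Complex.I)) (μ.prod μ) :=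
    Integrable.of_bound (Measurable.aestronglyMeasurable (by fun_prop)) 1
      (Filter.Eventually.of_forall fun p => (Complex.norm_exp_ofReal_mul_I _).le)
  have hre := integral_re hintegrable
  rw [charFun_neg, Complex.mul_conj, Complex.normSq_eq_norm_sq] at hc
  rw [← hc] at hre
  simp only [RCLike.re_to_complex, Complex.exp_ofReal_mul_I_re, Complex.ofReal_re] at hre
  rw [← hre]
  refine integral_congr_ae (Filter.Eventually.of_forall fun p => ?_)
  simp only
  rw [← cos_neg]
  congr 1
  ring

lemma integrable_snd_sub_fst {μ : Measure ℝ} [IsProbabilityMeasure μ]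
    (hμ : Integrable (fun x : ℝ => x) μ) :
    Integrable (fun p : ℝ × ℝ => p.2 - p.1) (μ.prod μ) :=
  (hμ.comp_snd μ).sub (hμ.comp_fst μ)

/-- Half of Gini's mean difference: `∫ F (1 - F) = ½ 𝔼|X - Y|` for independent `X, Y ∼ μ`. -/
lemma integral_measureReal_Iic_mul_one_sub {μ : Measure ℝ} [IsProbabilityMeasure μ]
    (hμ : Integrable (fun x : ℝ => x) μ) :
    ∫ x : ℝ, μ.real (Iic x) * (1 - μ.real (Iic x)) =
      2⁻¹ * ∫ p : ℝ × ℝ, |p.2 - p.1| ∂μ.prod μ := by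
  have hdiff := integrable_snd_sub_fst hμ
  have hpos : ∀ p : ℝ × ℝ, max (p.2 - p.1) 0 = 2⁻¹ * (|p.2 - p.1| + (p.2 - p.1)) := fun p => by
    rcases le_total (p.2 - p.1) 0 with h | h
    · rw [max_eq_right h, abs_of_nonpos h]; ring
    · rw [max_eq_left h, abs_of_nonneg h]; ring
  have hsection : ∀ p : ℝ × ℝ,
      ∫ x : ℝ, (Ico p.1 p.2).indicator (1 : ℝ → ℝ) x = max (p.2 - p.1) 0 := fun p => by
    rw [integral_indicator_one measurableSet_Ico, volume_real_Ico]
  have hslice : ∀ x : ℝ, ∫ p : ℝ × ℝ, (Ico p.1 p.2).indicator (1 : ℝ → ℝ) x ∂μ.prod μ =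
      μ.real (Iic x) * (1 - μ.real (Iic x)) := fun x => by
    have : ∀ p : ℝ × ℝ, (Ico p.1 p.2).indicator (1 : ℝ → ℝ) x =
        (Iic x ×ˢ Ioi x).indicator (1 : ℝ × ℝ → ℝ) p := fun p => by
      simp [indicator, mem_prod]
    simp_rw [this]
    rw [integral_indicator_one (measurableSet_Iic.prod measurableSet_Ioi), measureReal_prod_prod,
      ← compl_Iic, probReal_compl_eq_one_sub measurableSet_Iic]
  have hmeas : Measurable
      (Function.uncurry fun (p : ℝ × ℝ) (x : ℝ) => (Ico p.1 p.2).indicator (1 : ℝ → ℝ) x) := by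
    have hset : MeasurableSet {q : (ℝ × ℝ) × ℝ | q.1.1 ≤ q.2 ∧ q.2 < q.1.2} :=
      (measurableSet_le measurable_fst.fst measurable_snd).inter
        (measurableSet_lt measurable_snd measurable_fst.snd)
    exact measurable_one.indicator hset
  have hprod : Integrable
      (Function.uncurry fun (p : ℝ × ℝ) (x : ℝ) => (Ico p.1 p.2).indicator (1 : ℝ → ℝ) x)
      ((μ.prod μ).prod volume) := by
    rw [integrable_prod_iff hmeas.aestronglyMeasurable]
    refine ⟨Filter.Eventually.of_forall fun p => ?_, ?_⟩
    · have hone : IntegrableOn (1 : ℝ → ℝ) (Ico p.1 p.2) :=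
        integrableOn_const (C := (1 : ℝ)) measure_Ico_lt_top.ne
      exact hone.integrable_indicator measurableSet_Ico
    · have hnorm : ∀ (p : ℝ × ℝ) (x : ℝ), ‖(Ico p.1 p.2).indicator (1 : ℝ → ℝ) x‖ =
          (Ico p.1 p.2).indicator (1 : ℝ → ℝ) x := fun p x =>
        norm_of_nonneg (indicator_nonneg (fun _ _ => zero_le_one) x)
      simp only [Function.uncurry_apply_pair, hnorm, hsection, hpos]
      exact (hdiff.abs.add hdiff).const_mul _
  simp_rw [← hslice]
  rw [← integral_integral_swap hprod]
  simp_rw [hsection, hpos]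
  rw [integral_const_mul, integral_add hdiff.abs hdiff,
    integral_sub (hμ.comp_snd μ) (hμ.comp_fst μ), integral_fun_snd (fun x : ℝ => x),
    integral_fun_fst (fun x : ℝ => x)]
  simp

/-- **Parseval-like formula for distribution functions.** If `F` is an absolutely continuous
distribution function with density `f` and finite first moment, then
`∫ F(1-F) = (2π)⁻¹ ∫ t⁻² (1 - |φ_f(t)|²) dt`. -/
theorem psi_fourier_formula
    (μ : Measure ℝ) [IsProbabilityMeasure μ]
    (f : ℝ → ℝ) (hf_nonneg : ∀ x, 0 ≤ f x) (hf_int : Integrable f)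
    (hμ : μ = volume.withDensity (fun x => ENNReal.ofReal (f x)))
    (F : ℝ → ℝ) (hF : ∀ x, F x = ∫ y in Iic x, f y)
    (hFmom : Integrable (fun x : ℝ => x) μ) :
    ∫ x : ℝ, F x * (1 - F x) =
      (2 * π)⁻¹ * ∫ t : ℝ, (t ^ 2)⁻¹ * (1 - ‖fourierTr f t‖ ^ 2) := by
  have hfm : AEMeasurable (fun x => ENNReal.ofReal (f x)) := hf_int.aemeasurable.ennreal_ofReal
  have hFμ : ∀ x, F x = μ.real (Iic x) := fun x => by
    rw [hF, hμ, measureReal_def, withDensity_apply _ measurableSet_Iic,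
      integral_eq_lintegral_of_nonneg_ae (Filter.Eventually.of_forall hf_nonneg)
        hf_int.aestronglyMeasurable.restrict]
  have hφ : ∀ t, fourierTr f t = charFun μ t := fun t => by
    rw [charFun_apply_real, hμ, integral_withDensity_eq_integral_toReal_smul₀ hfm
      (Filter.Eventually.of_forall fun x => ENNReal.ofReal_lt_top), fourierTr]
    refine integral_congr_ae (Filter.Eventually.of_forall fun x => ?_)
    simp only [ENNReal.toReal_ofReal (hf_nonneg x), Complex.real_smul]
    rw [mul_comm]
    congr 2
    ring
  have hcosint : ∀ t : ℝ,
      Integrable (fun p : ℝ × ℝ => cos (t * (p.2 - p.1))) (μ.prod μ) := fun t =>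
    Integrable.of_bound (Measurable.aestronglyMeasurable (by fun_prop)) 1
      (Filter.Eventually.of_forall fun p => abs_cos_le_one _)
  have hkey := integral_mul_abs_mul_integral_inv_sq_mul_one_sub_cos (P := μ.prod μ)
    (w := fun _ => 1) (U := fun p => p.2 - p.1) measurable_const (by fun_prop)
    (by simpa using (integrable_snd_sub_fst hFmom).abs)
  simp_rw [one_mul, integral_inv_sq_mul_one_sub_cos] at hkey
  have hsq : ∀ t : ℝ, 1 - ‖fourierTr f t‖ ^ 2 =
      ∫ p : ℝ × ℝ, (1 - cos (t * (p.2 - p.1))) ∂μ.prod μ := fun t => by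
    rw [integral_sub (integrable_const 1) (hcosint t), hφ, norm_charFun_sq_eq_integral_cos]
    simp
  simp_rw [hsq, hFμ]
  rw [← hkey, integral_measureReal_Iic_mul_one_sub hFmom]
  field_simp
end

section
/- Let F be the distribution function of the normal distribution N(0, σ²) with σ > 0. Then ψ(F) = ∫ F(x){1 − F(x)} dx = σ π^{-1/2}. -/
open MeasureTheory Real Set

open Filter Topology

/-- The second fundamental theorem of calculus on the whole line, for a continuous nonnegative
derivative. -/
lemma integral_of_hasDerivAt_of_nonneg {G g : ℝ → ℝ} {m n : ℝ} (hg : Continuous g)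
    (hderiv : ∀ x, HasDerivAt G (g x) x) (hnonneg : ∀ x, 0 ≤ g x)
    (hbot : Tendsto G atBot (𝓝 m)) (htop : Tendsto G atTop (𝓝 n)) : ∫ x, g x = n - m := by
  have hcover : AECover (volume : Measure ℝ) atTop fun i : ℝ ↦ Ioc (-i) i :=
    aecover_Ioc tendsto_neg_atTop_atBot tendsto_id
  refine hcover.integral_eq_of_tendsto_of_nonneg_ae _ (ae_of_all _ hnonneg)
    (fun i ↦ hg.integrableOn_Ioc) ?_
  refine (htop.sub (hbot.comp tendsto_neg_atTop_atBot)).congr' ?_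
  filter_upwards [eventually_ge_atTop 0] with i hi
  rw [← intervalIntegral.integral_of_le (by linarith),
    intervalIntegral.integral_eq_sub_of_hasDerivAt (fun x _ ↦ hderiv x)
      (hg.intervalIntegrable _ _)]
  rfl

lemma hasDerivAt_integral_Iic {g : ℝ → ℝ} (hg : Continuous g) (hinteg : Integrable g) (x : ℝ) :
    HasDerivAt (fun u ↦ ∫ y in Iic u, g y) (g x) x := by
  have h : HasDerivAt (fun u ↦ (∫ y in Iic (0 : ℝ), g y) + ∫ y in (0 : ℝ)..u, g y) (g x) x :=
    (hg.integral_hasStrictDerivAt 0 x).hasDerivAt.const_add _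
  refine h.congr_of_eventuallyEq (Eventually.of_forall fun u ↦ ?_)
  simp only
  rw [← intervalIntegral.integral_Iic_sub_Iic hinteg.integrableOn hinteg.integrableOn]
  ring

lemma tendsto_integral_Iic_atTop {g : ℝ → ℝ} (hinteg : Integrable g) :
    Tendsto (fun u ↦ ∫ y in Iic u, g y) atTop (𝓝 (∫ y, g y)) :=
  (aecover_Iic tendsto_id).integral_tendsto_of_countably_generated hinteg

/-- If the density `g` has a first moment, then its left tail is `o(1 / x)`. -/
lemma tendsto_mul_integral_Iic_atBot {g : ℝ → ℝ} (hnonneg : ∀ x, 0 ≤ g x) (hinteg : Integrable g)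
    (hmoment : Integrable fun x ↦ x * g x) :
    Tendsto (fun x ↦ x * ∫ y in Iic x, g y) atBot (𝓝 0) := by
  have hlim : Tendsto (fun x : ℝ ↦ ∫ y in Iic x, y * g y) atBot (𝓝 0) :=
    tendsto_integral_Iic_zero tendsto_id
  refine tendsto_of_tendsto_of_tendsto_of_le_of_le' hlim tendsto_const_nhds ?_ ?_
  · filter_upwards with x
    rw [← integral_const_mul]
    exact setIntegral_mono_on hmoment.integrableOn (hinteg.const_mul x).integrableOn
      measurableSet_Iic fun y hy ↦ mul_le_mul_of_nonneg_right hy (hnonneg y)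
  · filter_upwards [eventually_le_atBot 0] with x hx
    exact mul_nonpos_of_nonpos_of_nonneg hx (integral_nonneg hnonneg)

/-- For an even density `g` of total mass one, the left and right tails are exchanged by
`x ↦ -x`. -/
lemma integral_Iic_neg_eq_one_sub {g : ℝ → ℝ} (heven : ∀ x, g (-x) = g x) (hinteg : Integrable g)
    (hone : ∫ y, g y = 1) (x : ℝ) : ∫ y in Iic (-x), g y = 1 - ∫ y in Iic x, g y := by
  have h := integral_comp_neg_Iic (-x) g
  simp only [heven, neg_neg] at h
  rw [h, ← hone, ← intervalIntegral.integral_Iic_add_Ioi (b := x) hinteg.integrableOn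
    hinteg.integrableOn]
  ring

/-- **`ψ(F)` for the normal distribution.** If `F` is the distribution function of
`N(0, σ²)` with `σ > 0`, then `∫ F(1-F) = σ π^{-1/2}`. -/
theorem psi_normal
    (σ : ℝ) (hσ : 0 < σ)
    (f : ℝ → ℝ)
    (hf : ∀ x, f x = (Real.sqrt (2 * π * σ ^ 2))⁻¹ * Real.exp (-(x ^ 2) / (2 * σ ^ 2)))
    (F : ℝ → ℝ) (hF : ∀ x, F x = ∫ y in Iic x, f y) :
    ∫ x : ℝ, F x * (1 - F x) = σ / Real.sqrt π := by
  obtain rfl : F = fun x ↦ ∫ y in Iic x, f y := funext hF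
  have hb : 0 < (2 * σ ^ 2)⁻¹ := by positivity
  have hf' : f = fun x ↦ (√(2 * π * σ ^ 2))⁻¹ * exp (-(2 * σ ^ 2)⁻¹ * x ^ 2) := by
    ext x; rw [hf]; congr 2; ring
  have hcont : Continuous f := by rw [hf']; fun_prop
  have hnonneg : ∀ x, 0 ≤ f x := fun x ↦ by rw [hf]; positivity
  have heven : ∀ x, f (-x) = f x := fun x ↦ by simp [hf]
  have hinteg : Integrable f := by rw [hf']; exact (integrable_exp_neg_mul_sq hb).const_mul _
  have hmoment : Integrable fun x ↦ x * f x := by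
    rw [hf']
    convert (integrable_mul_exp_neg_mul_sq hb).const_mul (√(2 * π * σ ^ 2))⁻¹ using 2 with x
    ring
  have hderiv : ∀ x, HasDerivAt f (-(σ ^ 2)⁻¹ * (x * f x)) x := fun x ↦ by
    rw [hf']
    refine (((hasDerivAt_pow 2 x).const_mul (-(2 * σ ^ 2)⁻¹)).exp.const_mul
      (√(2 * π * σ ^ 2))⁻¹).congr_deriv ?_
    push_cast
    field_simp
  have hone : ∫ y, f y = 1 := by
    rw [hf', integral_const_mul, integral_gaussian, div_inv_eq_mul,
      show π * (2 * σ ^ 2) = 2 * π * σ ^ 2 by ring]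
    exact inv_mul_cancel₀ (by positivity)
  have hsq : (fun x ↦ f x ^ 2) = fun x ↦ (2 * π * σ ^ 2)⁻¹ * exp (-(σ ^ 2)⁻¹ * x ^ 2) := by
    ext x
    rw [hf', mul_pow, inv_pow, sq_sqrt (by positivity), ← exp_nat_mul]
    congr 2
    push_cast
    field_simp
  have hsqint : Integrable fun x ↦ f x ^ 2 := by
    rw [hsq]; exact (integrable_exp_neg_mul_sq (by positivity)).const_mul _
  have hsqval : 2 * σ ^ 2 * ∫ y, f y ^ 2 = σ / √π := by
    rw [hsq, integral_const_mul, integral_gaussian, div_inv_eq_mul, sqrt_mul pi_pos.le,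
      sqrt_sq hσ.le]
    have hpi : √π ^ 2 = π := sq_sqrt pi_pos.le
    field_simp
    exact hpi
  have hfbot : Tendsto f atBot (𝓝 0) :=
    tendsto_zero_of_hasDerivAt_of_integrableOn_Iic (a := 0) (fun x _ ↦ hderiv x)
      (hmoment.const_mul _).integrableOn hinteg.integrableOn
  have hftop : Tendsto f atTop (𝓝 0) :=
    tendsto_zero_of_hasDerivAt_of_integrableOn_Ioi (a := 0) (fun x _ ↦ hderiv x)
      (hmoment.const_mul _).integrableOn hinteg.integrableOn
  set F : ℝ → ℝ := fun x ↦ ∫ y in Iic x, f y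
  have hFderiv : ∀ x, HasDerivAt F (f x) x := hasDerivAt_integral_Iic hcont hinteg
  have hFcont : Continuous F := continuous_iff_continuousAt.2 fun x ↦ (hFderiv x).continuousAt
  have hFneg : ∀ x, F (-x) = 1 - F x := integral_Iic_neg_eq_one_sub heven hinteg hone
  have hFnonneg : ∀ x, 0 ≤ F x := fun x ↦ integral_nonneg hnonneg
  have hFbot : Tendsto F atBot (𝓝 0) := tendsto_integral_Iic_zero tendsto_id
  have hFtop : Tendsto F atTop (𝓝 1) := hone ▸ tendsto_integral_Iic_atTop hinteg
  have hxbot : Tendsto (fun x ↦ x * F x * (1 - F x)) atBot (𝓝 0) := by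
    simpa using (tendsto_mul_integral_Iic_atBot hnonneg hinteg hmoment).mul (hFbot.const_sub 1)
  have hxtop : Tendsto (fun x ↦ x * F x * (1 - F x)) atTop (𝓝 0) := by
    have h := (hxbot.comp tendsto_neg_atTop_atBot).neg
    rw [neg_zero] at h
    refine h.congr fun x ↦ ?_
    simp only [Function.comp_apply, hFneg]
    ring
  have hG : ∀ x, HasDerivAt (fun x ↦ x * F x * (1 - F x) + σ ^ 2 * (f x * (1 - 2 * F x))
      + 2 * σ ^ 2 * ∫ y in Iic x, f y ^ 2) (F x * (1 - F x)) x := fun x ↦ by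
    refine (((((hasDerivAt_id x).mul (hFderiv x)).mul ((hFderiv x).const_sub 1)).add
      (((hderiv x).mul (((hFderiv x).const_mul 2).const_sub 1)).const_mul (σ ^ 2))).add
      ((hasDerivAt_integral_Iic (hcont.pow 2) hsqint x).const_mul (2 * σ ^ 2))).congr_deriv ?_
    simp only [id, Pi.mul_apply, Pi.pow_apply]
    field_simp
    ring
  have hGbot := (hxbot.add ((hfbot.mul ((hFbot.const_mul 2).const_sub 1)).const_mul (σ ^ 2))).add
    ((tendsto_integral_Iic_zero (f := fun y ↦ f y ^ 2) (μ := volume) tendsto_id).const_mul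
      (2 * σ ^ 2))
  have hGtop := (hxtop.add ((hftop.mul ((hFtop.const_mul 2).const_sub 1)).const_mul (σ ^ 2))).add
    ((tendsto_integral_Iic_atTop hsqint).const_mul (2 * σ ^ 2))
  rw [integral_of_hasDerivAt_of_nonneg (by fun_prop) hG
    (fun x ↦ mul_nonneg (hFnonneg x) (hFneg x ▸ hFnonneg (-x))) hGbot hGtop, hsqval]
  ring
end
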